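/- Let n > 0 and let M be a finite monoid in DA (i.e., satisfying (xyz)^ω·y·(xyz)^ω = (xyz)^ω for all x, y, z ∈ M) that is generated by n elements. Then M belongs to V_n. -/

import Mathlib

/-- The ω-power of an element of a finite monoid: `m ^ (card M)!`, which is
the unique idempotent among the positive powers of `m`. -/
def omegaPow {M : Type} [Monoid M] [Fintype M] (m : M) : M :=
  m ^ (Fintype.card M).factorial

/-- A monoid is `J`-trivial if equality of the two-sided ideals generated by
two elements implies equality of the elements. -/
def JTrivial (M : Type) [Monoid M] : Prop :=
  ∀ s t : M, {x : M | ∃ a b : M, a * s * b = x} = {x : M | ∃ a b : M, a * t * b = x} → s = t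

/-- A bundled finite monoid. -/
structure BFinMonoid : Type 1 where
  carrier : Type
  [mon : Monoid carrier]
  [fin : Fintype carrier]

attribute [instance] BFinMonoid.mon BFinMonoid.fin

/-- Auxiliary function for the transduction `τ_ψ`, accumulating the image of the
prefix read so far. -/
def tauAux {A N : Type} [Monoid N] (ψ : FreeMonoid A →* N) : N → List A → List (N × A × N)
  | _, [] => []
  | p, a :: rest =>
    (p, a, ψ (FreeMonoid.ofList rest)) :: tauAux ψ (p * ψ (FreeMonoid.of a)) rest

/-- The transduction `τ_ψ : A* → (N × A × N)*` sending `a₁ ⋯ aₙ` to `σ₁ ⋯ σₙ` where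
`σᵢ = (ψ(a₁ ⋯ a_{i-1}), aᵢ, ψ(a_{i+1} ⋯ aₙ))`. -/
def tau {A N : Type} [Monoid N] (ψ : FreeMonoid A →* N) (w : FreeMonoid A) :
    FreeMonoid (N × A × N) :=
  FreeMonoid.ofList (tauAux ψ 1 (FreeMonoid.toList w))

/-- Membership of a finite monoid `M` in `P ** J`, where `P` is a class of finite
monoids: there are a finite alphabet `A`, a surjective homomorphism `φ : A* → M`,
a homomorphism `ψ : A* → N` into a finite `J`-trivial monoid `N` and a homomorphism
`h : (N × A × N)* → K` into a finite monoid `K` with `P K`, such that `ψ v = ψ w`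
and `h (τ_ψ v) = h (τ_ψ w)` together imply `φ v = φ w`. -/
def MemBlockJ (P : BFinMonoid → Prop) (M : BFinMonoid) : Prop :=
  ∃ (A : Type) (_ : Fintype A) (φ : FreeMonoid A →* M.carrier), Function.Surjective φ ∧
    ∃ (N : BFinMonoid) (ψ : FreeMonoid A →* N.carrier), JTrivial N.carrier ∧
      ∃ (K : BFinMonoid) (h : FreeMonoid (N.carrier × A × N.carrier) →* K.carrier),
        P K ∧ ∀ v w : FreeMonoid A, ψ v = ψ w → h (tau ψ v) = h (tau ψ w) → φ v = φ w

/-- The sequence of pseudovarieties `V₁ = J`, `V_{n+1} = V_n ** J`, as membership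
predicates on bundled finite monoids (the value at `0` is unused). -/
def VMem : ℕ → BFinMonoid → Prop
  | 0, _ => True
  | 1, M => JTrivial M.carrier
  | n + 2, M => MemBlockJ (VMem (n + 1)) M

/-! ### Closure properties of the hierarchy -/

theorem JTrivial.eq {M : Type} [Monoid M] (hM : JTrivial M) {s t a b c d : M}
    (hs : s = a * t * b) (ht : t = c * s * d) : s = t := by
  refine hM s t (Set.ext fun x => ⟨?_, ?_⟩)
  · rintro ⟨p, q, rfl⟩
    exact ⟨p * a, b * q, by rw [hs]; simp only [mul_assoc]⟩
  · rintro ⟨p, q, rfl⟩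
    exact ⟨p * c, d * q, by rw [ht]; simp only [mul_assoc]⟩

theorem JTrivial.of_eq {M : Type} [Monoid M]
    (h : ∀ s t a b c d : M, s = a * t * b → t = c * s * d → s = t) : JTrivial M := by
  intro s t hst
  have hs : s ∈ {x : M | ∃ a b : M, a * t * b = x} := hst ▸ ⟨1, 1, by simp⟩
  have ht : t ∈ {x : M | ∃ a b : M, a * s * b = x} := hst ▸ ⟨1, 1, by simp⟩
  obtain ⟨a, b, hab⟩ := hs
  obtain ⟨c, d, hcd⟩ := ht
  exact h s t a b c d hab.symm hcd.symm

theorem JTrivial.prod {M N : Type} [Monoid M] [Monoid N] (hM : JTrivial M) (hN : JTrivial N) :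
    JTrivial (M × N) :=
  JTrivial.of_eq fun _ _ _ _ _ _ hs ht => Prod.ext
    (hM.eq (congrArg Prod.fst hs) (congrArg Prod.fst ht))
    (hN.eq (congrArg Prod.snd hs) (congrArg Prod.snd ht))

theorem JTrivial.of_subsingleton (M : Type) [Monoid M] [Subsingleton M] : JTrivial M :=
  fun _ _ _ => Subsingleton.elim _ _

theorem lift_id_surjective (M : Type) [Monoid M] :
    Function.Surjective (FreeMonoid.lift (id : M → M)) :=
  fun m => ⟨FreeMonoid.of m, by simp⟩

theorem VMem_of_jTrivial (n : ℕ) (M : BFinMonoid) (hM : JTrivial M.carrier) :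
    VMem (n + 1) M := by
  induction n generalizing M with
  | zero => exact hM
  | succ n ih =>
    refine ⟨M.carrier, M.fin, FreeMonoid.lift id, lift_id_surjective _, M, FreeMonoid.lift id, hM,
      ⟨PUnit⟩, 1, ih _ (JTrivial.of_subsingleton PUnit), fun v w h _ => h⟩

section Product

variable {A B N₁ N₂ : Type} [Monoid N₁] [Monoid N₂]

/-- Combine two homomorphisms on free monoids into one on the free monoid over the disjoint
union of the alphabets. -/
def sumHom (f : FreeMonoid A →* N₁) (g : FreeMonoid B →* N₂) : FreeMonoid (A ⊕ B) →* N₁ × N₂ :=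
  FreeMonoid.lift (Sum.elim (fun a => (f (FreeMonoid.of a), 1)) fun b => (1, g (FreeMonoid.of b)))

/-- Erase the letters of the second alphabet. -/
def eraseRight : List (A ⊕ B) → List A
  | [] => []
  | Sum.inl a :: l => a :: eraseRight l
  | Sum.inr _ :: l => eraseRight l

/-- Erase the letters of the first alphabet. -/
def eraseLeft : List (A ⊕ B) → List B
  | [] => []
  | Sum.inl _ :: l => eraseLeft l
  | Sum.inr b :: l => b :: eraseLeft l

theorem sumHom_apply (f : FreeMonoid A →* N₁) (g : FreeMonoid B →* N₂) (l : List (A ⊕ B)) :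
    sumHom f g (FreeMonoid.ofList l) =
      (f (FreeMonoid.ofList (eraseRight l)), g (FreeMonoid.ofList (eraseLeft l))) := by
  induction l with
  | nil => simp [eraseRight, eraseLeft, Prod.ext_iff]
  | cons x l ih =>
    rw [FreeMonoid.ofList_cons, map_mul, ih]
    cases x <;> simp [sumHom, eraseRight, eraseLeft, FreeMonoid.ofList_cons]

theorem sumHom_surjective {f : FreeMonoid A →* N₁} {g : FreeMonoid B →* N₂}
    (hf : Function.Surjective f) (hg : Function.Surjective g) :
    Function.Surjective (sumHom f g) := by
  rintro ⟨x, y⟩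
  obtain ⟨v, rfl⟩ := hf x
  obtain ⟨w, rfl⟩ := hg y
  have h₁ : (sumHom f g).comp (FreeMonoid.map Sum.inl) = (MonoidHom.inl N₁ N₂).comp f :=
    FreeMonoid.hom_eq fun a => by simp [sumHom]
  have h₂ : (sumHom f g).comp (FreeMonoid.map Sum.inr) = (MonoidHom.inr N₁ N₂).comp g :=
    FreeMonoid.hom_eq fun a => by simp [sumHom]
  refine ⟨FreeMonoid.map Sum.inl v * FreeMonoid.map Sum.inr w, ?_⟩
  have h₁ := DFunLike.congr_fun h₁ v
  have h₂ := DFunLike.congr_fun h₂ w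
  simp only [MonoidHom.comp_apply] at h₁ h₂
  rw [map_mul, h₁, h₂]
  simp

variable {K₁ K₂ : Type} [Monoid K₁] [Monoid K₂]

/-- The labelling homomorphism acting on each letter of the disjoint union through the
homomorphism belonging to its alphabet. -/
def sumLabel (h : FreeMonoid (N₁ × A × N₁) →* K₁) (k : FreeMonoid (N₂ × B × N₂) →* K₂) :
    FreeMonoid ((N₁ × N₂) × (A ⊕ B) × (N₁ × N₂)) →* K₁ × K₂ :=
  FreeMonoid.lift fun x => Sum.elim
    (fun a => (h (FreeMonoid.of (x.1.1, a, x.2.2.1)), 1))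
    (fun b => (1, k (FreeMonoid.of (x.1.2, b, x.2.2.2)))) x.2.1

theorem sumLabel_tauAux (f : FreeMonoid A →* N₁) (g : FreeMonoid B →* N₂)
    (h : FreeMonoid (N₁ × A × N₁) →* K₁) (k : FreeMonoid (N₂ × B × N₂) →* K₂)
    (p : N₁ × N₂) (l : List (A ⊕ B)) :
    sumLabel h k (FreeMonoid.ofList (tauAux (sumHom f g) p l)) =
      (h (FreeMonoid.ofList (tauAux f p.1 (eraseRight l))),
        k (FreeMonoid.ofList (tauAux g p.2 (eraseLeft l)))) := by
  induction l generalizing p with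
  | nil => simp [tauAux, eraseRight, eraseLeft, Prod.ext_iff]
  | cons x l ih =>
    rw [tauAux, FreeMonoid.ofList_cons, map_mul, ih, sumHom_apply]
    cases x <;>
      simp [sumHom, sumLabel, eraseRight, eraseLeft, FreeMonoid.ofList_cons, tauAux]

end Product

theorem VMem_prod (n : ℕ) (K₁ K₂ : BFinMonoid) (h₁ : VMem (n + 1) K₁) (h₂ : VMem (n + 1) K₂) :
    VMem (n + 1) ⟨K₁.carrier × K₂.carrier⟩ := by
  induction n generalizing K₁ K₂ with
  | zero => exact JTrivial.prod h₁ h₂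
  | succ n ih =>
    obtain ⟨A, hA, φ₁, hφ₁, N₁, ψ₁, hN₁, L₁, k₁, hL₁, H₁⟩ := h₁
    obtain ⟨B, hB, φ₂, hφ₂, N₂, ψ₂, hN₂, L₂, k₂, hL₂, H₂⟩ := h₂
    refine ⟨A ⊕ B, inferInstance, sumHom φ₁ φ₂, sumHom_surjective hφ₁ hφ₂,
      ⟨N₁.carrier × N₂.carrier⟩, sumHom ψ₁ ψ₂, hN₁.prod hN₂,
      ⟨L₁.carrier × L₂.carrier⟩, sumLabel k₁ k₂, ih _ _ hL₁ hL₂, fun v w hψ hτ => ?_⟩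
    have hψ' := (sumHom_apply ψ₁ ψ₂ v.toList).symm.trans (hψ.trans (sumHom_apply ψ₁ ψ₂ w.toList))
    have hτ' := (sumLabel_tauAux ψ₁ ψ₂ k₁ k₂ 1 v.toList).symm.trans
      (hτ.trans (sumLabel_tauAux ψ₁ ψ₂ k₁ k₂ 1 w.toList))
    refine (sumHom_apply φ₁ φ₂ v.toList).trans (Eq.trans ?_ (sumHom_apply φ₁ φ₂ w.toList).symm)
    exact Prod.ext
      (H₁ _ _ (congrArg Prod.fst hψ') (congrArg Prod.fst hτ'))
      (H₂ _ _ (congrArg Prod.snd hψ') (congrArg Prod.snd hτ'))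

/-- A relation on words is refined by the kernel of a homomorphism into a monoid at the
given level of the hierarchy. -/
def RefinedBy (n : ℕ) {B : Type} (R : FreeMonoid B → FreeMonoid B → Prop) : Prop :=
  ∃ (K : BFinMonoid) (h : FreeMonoid B →* K.carrier), VMem (n + 1) K ∧
    ∀ x y, h x = h y → R x y

theorem RefinedBy.and {n : ℕ} {B : Type} {R S : FreeMonoid B → FreeMonoid B → Prop}
    (hR : RefinedBy n R) (hS : RefinedBy n S) : RefinedBy n fun x y => R x y ∧ S x y := by
  obtain ⟨K, h, hK, H⟩ := hR
  obtain ⟨L, k, hL, H'⟩ := hS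
  exact ⟨⟨K.carrier × L.carrier⟩, h.prod k, VMem_prod n K L hK hL, fun x y hxy =>
    ⟨H x y (congrArg Prod.fst hxy), H' x y (congrArg Prod.snd hxy)⟩⟩

theorem RefinedBy.forall {n : ℕ} {B ι : Type} [Finite ι]
    {R : ι → FreeMonoid B → FreeMonoid B → Prop} (hR : ∀ i, RefinedBy n (R i)) :
    RefinedBy n fun x y => ∀ i, R i x y := by
  classical
  have := Fintype.ofFinite ι
  suffices h : ∀ s : Finset ι, RefinedBy n fun x y => ∀ i ∈ s, R i x y by
    simpa using h Finset.univ
  intro s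
  induction s using Finset.induction_on with
  | empty =>
    exact ⟨⟨PUnit⟩, 1, VMem_of_jTrivial n _ (JTrivial.of_subsingleton PUnit), by simp⟩
  | insert a s _ ih => simpa using (hR a).and ih

/-! ### Universality of words and blocks of letters -/

/-- All words of length `i` are scattered subwords of `l`. -/
def Universal {A : Type} (l : List A) (i : ℕ) : Prop :=
  ∀ u : List A, u.length = i → u.Sublist l

section Blocks

variable {A : Type}

theorem universal_zero (l : List A) : Universal l 0 := by
  intro u hu
  simp [List.length_eq_zero_iff.1 hu]

theorem Universal.cons {l : List A} {i : ℕ} (h : Universal l i) (a : A) : Universal (a :: l) i :=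
  fun u hu => (h u hu).cons a

theorem Universal.of_cons {l : List A} {i : ℕ} {a : A} (h : Universal (a :: l) (i + 1)) :
    Universal l i :=
  fun u hu => List.cons_sublist_cons.1 (h (a :: u) (by simp [hu]))

theorem Universal.of_succ {l : List A} {i : ℕ} (h : Universal l (i + 1)) : Universal l i := by
  cases l with
  | nil =>
    intro u hu
    cases u with
    | nil => simp
    | cons a u => simpa using h (a :: a :: u) (by simpa using hu)
  | cons a l => exact h.of_cons.cons a

theorem Universal.mono {l : List A} {i j : ℕ} (h : Universal l j) (hij : i ≤ j) :
    Universal l i := by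
  induction hij with
  | refl => exact h
  | step _ ih => exact ih h.of_succ

theorem universal_reverse {l : List A} {i : ℕ} : Universal l.reverse i ↔ Universal l i := by
  constructor
  · intro h u hu
    simpa using (h u.reverse (by simpa using hu))
  · intro h u hu
    have := (h u.reverse (by simpa using hu)).reverse
    simpa using this

theorem not_universal_nil [Nonempty A] (i : ℕ) : ¬ Universal ([] : List A) (i + 1) := by
  intro h
  obtain ⟨a⟩ := ‹Nonempty A›
  simpa using h (List.replicate (i + 1) a) (by simp)

open Classical in
/-- The shortest suffix of `l` that is universal of level `i` (if there is one). -/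
noncomputable def arch (i : ℕ) : List A → List A
  | [] => []
  | a :: l => if Universal l i then arch i l else a :: l

open Classical in
/-- The letters of `l` strictly between the shortest suffixes universal of levels `i`
and `i + 1`. -/
noncomputable def block (i : ℕ) : List A → List A
  | [] => []
  | a :: l => if Universal l i ∧ ¬ Universal (a :: l) (i + 1) then a :: block i l else block i l

theorem arch_zero (l : List A) : arch 0 l = [] := by
  induction l with
  | nil => rfl
  | cons a l ih => simp [arch, universal_zero, ih]

theorem exists_append_arch (i : ℕ) (l : List A) : ∃ u, l = u ++ arch i l := by
  induction l with
  | nil => exact ⟨[], rfl⟩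
  | cons a l ih =>
    by_cases h : Universal l i
    · obtain ⟨u, hu⟩ := ih
      exact ⟨a :: u, by rw [arch, if_pos h, List.cons_append, ← hu]⟩
    · exact ⟨[], by rw [arch, if_neg h]; rfl⟩

theorem universal_arch {i : ℕ} {l : List A} (h : Universal l i) : Universal (arch i l) i := by
  induction l with
  | nil => exact h
  | cons a l ih =>
    rw [arch]
    split_ifs with h'
    exacts [ih h', h]

theorem not_universal_of_arch_eq_cons {i : ℕ} {l q : List A} {a : A} (h : arch i l = a :: q) :
    ¬ Universal q i := by
  induction l with
  | nil => simp [arch] at h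
  | cons b l ih =>
    rw [arch] at h
    split_ifs at h with h'
    · exact ih h
    · obtain ⟨rfl, rfl⟩ := List.cons.inj h
      exact h'

theorem sublist_of_cons_sublist_append {b : A} {u r l : List A} (hb : b ∉ u)
    (h : (b :: r).Sublist (u ++ l)) : (b :: r).Sublist l := by
  induction u with
  | nil => exact h
  | cons c u ih =>
    simp only [List.mem_cons, not_or] at hb
    rw [List.cons_append] at h
    cases h with
    | cons _ h => exact ih hb.2 h
    | cons_cons _ h => exact absurd rfl hb.1

theorem universal_append_arch {i : ℕ} {l u : List A} (h : Universal l i) :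
    Universal (u ++ arch i l) (i + 1) ↔ ∀ b, b ∈ u := by
  constructor
  · intro hu b
    by_contra hb
    rcases hq : arch i l with _ | ⟨a, q⟩
    · rw [hq] at hu
      have := sublist_of_cons_sublist_append hb (hu (b :: List.replicate i b) (by simp))
      simp at this
    · have hq' := not_universal_of_arch_eq_cons hq
      refine hq' fun r hr => ?_
      rw [hq] at hu
      have := sublist_of_cons_sublist_append hb (hu (b :: r) (by simp [hr]))
      cases this with
      | cons _ h => exact (List.sublist_cons_self b r).trans h
      | cons_cons _ h => exact h
  · intro hu r hr
    cases r with
    | nil => simp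
    | cons b r =>
      have h₁ : [b].Sublist u := List.singleton_sublist.2 (hu b)
      exact h₁.append (universal_arch h r (by simpa using hr))

theorem block_eq_nil {i : ℕ} {l : List A} (h : ¬ Universal l i) : block i l = [] := by
  induction l with
  | nil => rfl
  | cons a l ih =>
    have hl : ¬ Universal l i := fun h' => h (h'.cons a)
    simp [block, hl, ih]

theorem block_append_arch {i : ℕ} {l : List A} (h : ¬ Universal l (i + 1)) :
    l = block i l ++ arch i l := by
  induction l with
  | nil => rfl
  | cons a l ih =>
    by_cases h' : Universal l i
    · have := ih fun h'' => h (h''.cons a)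
      rw [block, if_pos ⟨h', h⟩, arch, if_pos h', List.cons_append, ← this]
    · rw [block, if_neg (fun h'' => h' h''.1), arch, if_neg h', block_eq_nil h', List.nil_append]

theorem exists_notMem_block {i : ℕ} {l : List A} (h : Universal l i)
    (h' : ¬ Universal l (i + 1)) : ∃ a, a ∉ block i l := by
  by_contra! hb
  exact h' (by rw [block_append_arch h']; exact (universal_append_arch h).2 hb)

theorem exists_arch_succ [Nonempty A] {i : ℕ} {l : List A} (h : Universal l (i + 1)) :
    ∃ a, arch (i + 1) l = a :: (block i l ++ arch i l) ∧ ∀ b, b ∈ block i l ↔ b ≠ a := by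
  induction l with
  | nil => exact absurd h (not_universal_nil i)
  | cons a l ih =>
    have hi : Universal l i := h.of_cons
    rw [block, if_neg (fun h' => h'.2 h), arch, arch, if_pos hi]
    by_cases h' : Universal l (i + 1)
    · rw [if_pos h']
      exact ih h'
    · rw [if_neg h', ← block_append_arch h']
      refine ⟨a, rfl, ?_⟩
      rw [block_append_arch h', ← List.cons_append, universal_append_arch hi] at h
      obtain ⟨c, hc⟩ := exists_notMem_block hi h'
      have hca : c = a := by simpa [hc] using h c
      subst hca
      intro b
      constructor
      · rintro hb rfl
        exact hc hb
      · intro hb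
        simpa [hb] using h b

theorem prod_map_ite_of_notMem [DecidableEq A] {M : Type} [Monoid M] (g : A → M) {a : A}
    {l : List A} (ha : a ∉ l) :
    (l.map fun b => if b = a then 1 else g b).prod = (l.map g).prod := by
  congr 1
  refine List.map_congr_left fun b hb => if_neg ?_
  rintro rfl
  exact ha hb

/-- The blocks of `v` and `w` below level `k` have the same letters, and the same values after
deleting any given letter. -/
structure SameBlocks [DecidableEq A] {M : Type} [Monoid M] (g : A → M) (k : ℕ)
    (v w : List A) : Prop where
  universal : ∀ i ≤ k, Universal v i ↔ Universal w i
  mem : ∀ i < k, ∀ a, a ∈ block i v ↔ a ∈ block i w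
  prod : ∀ i < k, ∀ a, ((block i v).map fun b => if b = a then 1 else g b).prod =
    ((block i w).map fun b => if b = a then 1 else g b).prod

theorem SameBlocks.prod_block [DecidableEq A] {M : Type} [Monoid M] {g : A → M} {k : ℕ}
    {v w : List A} (h : SameBlocks g k v w) {i : ℕ} (hi : i < k) {a : A} (ha : a ∉ block i v) :
    ((block i v).map g).prod = ((block i w).map g).prod := by
  rw [← prod_map_ite_of_notMem g ha, h.prod i hi a,
    prod_map_ite_of_notMem g (mt (h.mem i hi a).2 ha)]

theorem SameBlocks.prod_arch [Nonempty A] [DecidableEq A] {M : Type} [Monoid M] {g : A → M} {k : ℕ}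
    {v w : List A} (h : SameBlocks g k v w) {i : ℕ} (hi : i ≤ k) (hv : Universal v i) :
    ((arch i v).map g).prod = ((arch i w).map g).prod := by
  induction i with
  | zero => simp [arch_zero]
  | succ i ih =>
    have hw := (h.universal _ hi).1 hv
    obtain ⟨a, hva, ha⟩ := exists_arch_succ hv
    obtain ⟨b, hwb, hb⟩ := exists_arch_succ hw
    have hav : a ∉ block i v := fun h' => (ha a).1 h' rfl
    have haw : a ∉ block i w := mt (h.mem i hi a).2 hav
    have hab : a = b := by
      by_contra hab
      exact haw ((hb a).2 hab)
    subst hab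
    simp only [hva, hwb, List.map_cons, List.map_append, List.prod_cons, List.prod_append]
    rw [h.prod_block hi hav, ih (by omega) hv.of_succ]

theorem SameBlocks.prod_eq_of_not_universal [Nonempty A] [DecidableEq A] {M : Type} [Monoid M]
    {g : A → M} {k : ℕ} {v w : List A} (h : SameBlocks g k v w) (hv : ¬ Universal v k) :
    (v.map g).prod = (w.map g).prod := by
  classical
  have hex : ∃ j, ¬ Universal v j := ⟨k, hv⟩
  have hj := Nat.find_spec hex
  have hjk : Nat.find hex ≤ k := Nat.find_min' hex hv
  rcases hi : Nat.find hex with _ | i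
  · rw [hi] at hj
    exact absurd (universal_zero v) hj
  · have hvi : Universal v i := not_not.1 (Nat.find_min hex (by omega))
    rw [hi] at hj hjk
    have hw := mt (h.universal _ hjk).2 hj
    obtain ⟨a, ha⟩ := exists_notMem_block hvi hj
    rw [block_append_arch hj, block_append_arch hw, List.map_append, List.map_append,
      List.prod_append, List.prod_append, h.prod_block hjk ha, h.prod_arch (by omega) hvi]

/-- The letters of `l` in the `i`-th block from the left of `q.reverse ++ l`. -/
noncomputable def blockFrom (i : ℕ) : List A → List A → List A
  | _, [] => []
  | q, a :: l =>
    open Classical in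
    if Universal q i ∧ ¬ Universal (a :: q) (i + 1) then a :: blockFrom i (a :: q) l
    else blockFrom i (a :: q) l

theorem reverse_block (i : ℕ) (q l : List A) :
    (block i (l.reverse ++ q)).reverse = (block i q).reverse ++ blockFrom i q l := by
  induction l generalizing q with
  | nil => simp [blockFrom]
  | cons a l ih =>
    rw [List.reverse_cons, List.append_assoc, List.singleton_append, ih, block, blockFrom]
    split_ifs <;> simp

theorem blockFrom_nil (i : ℕ) (l : List A) : blockFrom i [] l = (block i l.reverse).reverse := by
  simpa [block] using (reverse_block i [] l).symm

end Blocks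

/-! ### Monoids in `DA` -/

/-- Every factor `a` of an idempotent `e` satisfies `e * a * e = e`. -/
def AbsorbsFactors (M : Type) [Monoid M] : Prop :=
  ∀ e u a v : M, e * e = e → e = u * a * v → e * a * e = e

theorem absorbsFactors_of_omegaPow {M : Type} [Monoid M] [Fintype M]
    (hDA : ∀ x y z : M,
      omegaPow (x * y * z) * y * omegaPow (x * y * z) = omegaPow (x * y * z)) :
    AbsorbsFactors M := by
  intro e u a v he h
  have hω : omegaPow e = e :=
    IsIdempotentElem.pow_eq he (Nat.factorial_pos _).ne'
  have := hDA u a v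
  rwa [← h, hω] at this

theorem AbsorbsFactors.submonoid {M : Type} [Monoid M] (hM : AbsorbsFactors M)
    (S : Submonoid M) : AbsorbsFactors S :=
  fun e u a v he h => Subtype.ext (hM e u a v (congrArg Subtype.val he) (congrArg Subtype.val h))

theorem AbsorbsFactors.op {M : Type} [Monoid M] (hM : AbsorbsFactors M) :
    AbsorbsFactors Mᵐᵒᵖ := by
  intro e u a v he h
  apply MulOpposite.unop_injective
  have := hM e.unop v.unop a.unop u.unop (by rw [← MulOpposite.unop_mul, he])
    (by rw [h]; simp [mul_assoc])
  simpa [mul_assoc] using this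

theorem exists_pow_idempotent {M : Type} [Monoid M] [Finite M] (x : M) :
    ∃ n, 0 < n ∧ x ^ n * x ^ n = x ^ n := by
  obtain ⟨i, j, hij, h⟩ := Finite.exists_ne_map_eq_of_infinite (fun n : ℕ => x ^ n)
  wlog hlt : i < j generalizing i j
  · exact this j i hij.symm h.symm (by omega)
  obtain ⟨d, rfl⟩ := Nat.exists_eq_add_of_lt hlt
  have hstep : ∀ m, x ^ (i + m) = x ^ (i + m + (d + 1)) := by
    intro m
    have h : x ^ i = x ^ (i + d + 1) := h
    rw [pow_add, h, ← pow_add]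
    congr 1
    omega
  have hmul : ∀ c m, x ^ (i + m) = x ^ (i + m + c * (d + 1)) := by
    intro c
    induction c with
    | zero => simp
    | succ c ih =>
      intro m
      rw [ih m, add_assoc i m, hstep (m + c * (d + 1))]
      congr 1
      ring
  refine ⟨(i + 1) * (d + 1), by positivity, ?_⟩
  have := hmul (i + 1) ((i + 1) * (d + 1) - i)
  have hle : i ≤ (i + 1) * (d + 1) := by nlinarith [Nat.zero_le (i * d)]
  rw [Nat.add_sub_cancel' hle] at this
  rw [← pow_add, ← this]

theorem AbsorbsFactors.exists_pow_succ_eq {M : Type} [Monoid M] [Finite M]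
    (hM : AbsorbsFactors M) (x : M) : ∃ n, x ^ (n + 1) = x ^ n := by
  obtain ⟨n, hn, he⟩ := exists_pow_idempotent x
  refine ⟨n, ?_⟩
  obtain ⟨m, rfl⟩ := Nat.exists_eq_add_of_lt hn
  have h := hM _ 1 x (x ^ (0 + m)) he (by rw [one_mul, pow_succ'])
  have hc : x ^ (0 + m + 1) * x * x ^ (0 + m + 1) = x ^ (0 + m + 1) * x ^ (0 + m + 1) * x := by
    simp only [← pow_succ, ← pow_add]
    congr 1
    omega
  rw [hc, he, ← pow_succ] at h
  exact h

theorem AbsorbsFactors.eq_of_mul_eq {M : Type} [Monoid M] [Finite M]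
    (hM : AbsorbsFactors M) {s t b c : M} (ht : t = s * b) (hs : s = c * t) : s = t := by
  obtain ⟨n, hn⟩ := hM.exists_pow_succ_eq b
  have h : ∀ m, s = c ^ m * s * b ^ m := by
    intro m
    induction m with
    | zero => simp
    | succ m ih =>
      calc s = c * (s * b) := by rw [← ht]; exact hs
        _ = c * ((c ^ m * s * b ^ m) * b) := by rw [← ih]
        _ = _ := by rw [pow_succ', pow_succ]; simp only [mul_assoc]
  calc s = c ^ n * s * b ^ n := h n
    _ = c ^ n * s * b ^ n * b := by rw [mul_assoc _ _ b, ← pow_succ, hn]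
    _ = s * b := by rw [← h n]
    _ = t := ht.symm

/-- If every element of a generating set is a factor of an idempotent `e`, then
`e * s * e = e` for all `s`. -/
theorem AbsorbsFactors.mul_mul_eq {M : Type} [Monoid M] (hM : AbsorbsFactors M) {A : Type}
    {g : A → M} (hg : Submonoid.closure (Set.range g) = ⊤) {e : M} (he : e * e = e)
    (hfac : ∀ a, ∃ u v, e = u * g a * v) (s : M) : e * s * e = e := by
  have hs : s ∈ Submonoid.closure (Set.range g) := hg ▸ Submonoid.mem_top s
  induction hs using Submonoid.closure_induction_right with
  | one => simpa using he
  | mul_right s hs y hy ih =>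
    obtain ⟨a, rfl⟩ := hy
    obtain ⟨u, v, huv⟩ := hfac a
    have hidem : e * s * (e * s) = e * s := by rw [← mul_assoc, ih]
    have h := hM (e * s) u (g a) (v * s) hidem (by rw [← mul_assoc, ← huv])
    calc e * (s * g a) * e = e * s * g a * (e * s * e) := by rw [ih]; simp only [mul_assoc]
      _ = e * s * g a * (e * s) * e := by simp only [mul_assoc]
      _ = e := by rw [h, ih]

theorem exists_mul_prod_arch {A : Type} {M : Type} [Monoid M] (g : A → M) (i : ℕ) (l : List A) :
    ∃ d, (l.map g).prod = d * ((arch i l).map g).prod := by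
  obtain ⟨u, hu⟩ := exists_append_arch i l
  refine ⟨(u.map g).prod, ?_⟩
  conv_lhs => rw [hu]
  rw [List.map_append, List.prod_append]

theorem exists_arch_eq_append {A : Type} [Nonempty A] {l : List A} {i j : ℕ} (hij : i < j)
    (h : Universal l j) : ∃ u, arch j l = u ++ arch i l ∧ ∀ b, b ∈ u := by
  induction j, hij using Nat.le_induction with
  | base =>
    obtain ⟨a, ha, hb⟩ := exists_arch_succ h
    refine ⟨a :: block i l, ha, fun b => ?_⟩
    by_cases hba : b = a
    · simp [hba]
    · simp [(hb b).2 hba]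
  | succ j hj ih =>
    obtain ⟨u, hu, hmem⟩ := ih h.of_succ
    obtain ⟨a, ha, -⟩ := exists_arch_succ h
    exact ⟨a :: block j l ++ u, by rw [ha, hu]; simp, fun b => by simp [hmem b]⟩

theorem AbsorbsFactors.exists_prod_arch_eq {M : Type} [Monoid M] [Fintype M]
    (hM : AbsorbsFactors M) {A : Type} [Nonempty A] {g : A → M}
    (hg : Submonoid.closure (Set.range g) = ⊤) {l : List A}
    (hl : Universal l (Fintype.card M)) :
    ∃ c, ((arch (Fintype.card M) l).map g).prod = c * (l.map g).prod := by
  obtain ⟨i, j, hij, heq⟩ := Fintype.exists_ne_map_eq_of_card_lt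
    (fun i : Fin (Fintype.card M + 1) => ((arch i l).map g).prod) (by simp)
  wlog hlt : i < j generalizing i j
  · exact this j i hij.symm heq.symm (lt_of_le_of_ne (not_lt.1 hlt) hij.symm)
  obtain ⟨u, hu, hmem⟩ := exists_arch_eq_append hlt (hl.mono (Nat.le_of_lt_succ j.2))
  have hm : ((arch i l).map g).prod = (u.map g).prod * ((arch i l).map g).prod := by
    rw [← List.prod_append, ← List.map_append, ← hu]
    exact heq
  obtain ⟨t, ht⟩ : ∃ t, ((arch (Fintype.card M) l).map g).prod =
      t * ((arch i l).map g).prod := by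
    obtain ⟨v, hv, -⟩ := exists_arch_eq_append (lt_of_lt_of_le hlt (Nat.le_of_lt_succ j.2)) hl
    exact ⟨(v.map g).prod, by rw [hv, List.map_append, List.prod_append]⟩
  obtain ⟨n, hn, he⟩ := exists_pow_idempotent (u.map g).prod
  obtain ⟨d, hd⟩ := exists_mul_prod_arch g i l
  have hpow : ∀ n, (u.map g).prod ^ n * ((arch i l).map g).prod = ((arch i l).map g).prod := by
    intro n
    induction n with
    | zero => simp
    | succ n ih => rw [pow_succ, mul_assoc, ← hm, ih]
  have hfac : ∀ a, ∃ x y, (u.map g).prod ^ n = x * g a * y := by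
    intro a
    obtain ⟨p, q, hpq⟩ := List.append_of_mem (hmem a)
    obtain ⟨m, rfl⟩ := Nat.exists_eq_add_of_lt hn
    refine ⟨(p.map g).prod, (q.map g).prod * (u.map g).prod ^ (0 + m), ?_⟩
    rw [pow_succ']
    conv_lhs => enter [1]; rw [hpq]
    simp [mul_assoc]
  have hstab := hM.mul_mul_eq hg he hfac d
  refine ⟨t * (u.map g).prod ^ n, ?_⟩
  rw [ht, mul_assoc, hd]
  congr 1
  calc ((arch i l).map g).prod
      = (u.map g).prod ^ n * d * (u.map g).prod ^ n * ((arch i l).map g).prod := by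
        rw [hstab, hpow]
    _ = _ := by rw [mul_assoc _ _ ((arch i l).map g).prod, hpow, mul_assoc]

theorem AbsorbsFactors.exists_prod_eq_mul {M : Type} [Monoid M] [Fintype M]
    (hM : AbsorbsFactors M) {A : Type} [Nonempty A] [DecidableEq A] {g : A → M}
    (hg : Submonoid.closure (Set.range g) = ⊤) {v w : List A}
    (h : SameBlocks g (Fintype.card M) v w) (hv : Universal v (Fintype.card M)) :
    ∃ c, (w.map g).prod = c * (v.map g).prod := by
  obtain ⟨c, hc⟩ := hM.exists_prod_arch_eq hg hv
  obtain ⟨d, hd⟩ := exists_mul_prod_arch g (Fintype.card M) w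
  exact ⟨d * c, by rw [hd, ← h.prod_arch le_rfl hv, hc, mul_assoc]⟩

theorem op_prod_map {A M : Type} [Monoid M] (g : A → M) (l : List A) :
    (l.map fun a => MulOpposite.op (g a)).prod = MulOpposite.op (l.reverse.map g).prod := by
  induction l with
  | nil => rfl
  | cons a l ih => simp [ih]

theorem closure_range_op {A M : Type} [Monoid M] {g : A → M}
    (hg : Submonoid.closure (Set.range g) = ⊤) :
    Submonoid.closure (Set.range fun a => MulOpposite.op (g a)) = ⊤ := by
  rw [eq_top_iff]
  intro x _
  have hx : x.unop ∈ Submonoid.closure (Set.range g) := hg ▸ Submonoid.mem_top _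
  obtain ⟨y, rfl⟩ := MulOpposite.op_surjective x
  rw [MulOpposite.unop_op] at hx
  induction hx using Submonoid.closure_induction with
  | mem y hy =>
    obtain ⟨a, rfl⟩ := hy
    exact Submonoid.subset_closure ⟨a, rfl⟩
  | one => exact one_mem _
  | mul y z _ _ hy hz =>
    rw [MulOpposite.op_mul]
    exact mul_mem (hz trivial) (hy trivial)

theorem AbsorbsFactors.prod_eq {M : Type} [Monoid M] [Fintype M]
    (hM : AbsorbsFactors M) {A : Type} [Nonempty A] [DecidableEq A] {g : A → M}
    (hg : Submonoid.closure (Set.range g) = ⊤) {v w : List A}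
    (h : SameBlocks g (Fintype.card M) v w)
    (h' : SameBlocks (fun a => MulOpposite.op (g a)) (Fintype.card M) v.reverse w.reverse)
    (h'' : SameBlocks g (Fintype.card M) w v) :
    (v.map g).prod = (w.map g).prod := by
  by_cases hv : Universal v (Fintype.card M)
  · have hw := (h.universal _ le_rfl).1 hv
    obtain ⟨c, hc⟩ := hM.exists_prod_eq_mul hg h'' hw
    let _ : Fintype Mᵐᵒᵖ := Fintype.ofEquiv M MulOpposite.opEquiv
    have hcard : Fintype.card Mᵐᵒᵖ = Fintype.card M := Fintype.card_congr MulOpposite.opEquiv.symm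
    rw [← hcard] at h' hv
    obtain ⟨b, hb⟩ := hM.op.exists_prod_eq_mul (closure_range_op hg) h'
      (universal_reverse.2 hv)
    rw [op_prod_map, op_prod_map, List.reverse_reverse, List.reverse_reverse] at hb
    exact hM.eq_of_mul_eq (b := b.unop) (by simpa using congrArg MulOpposite.unop hb) hc
  · exact h.prod_eq_of_not_universal hv

/-! ### Piecewise testable congruences -/

/-- Two words are congruent if they have the same scattered subwords of length at most `k`. -/
def subwordCon (A : Type) (k : ℕ) : Con (FreeMonoid A) where
  r v w := ∀ u : List A, u.length ≤ k → (u.Sublist v.toList ↔ u.Sublist w.toList)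
  iseqv := ⟨fun _ _ _ => Iff.rfl, fun h u hu => (h u hu).symm,
    fun h h' u hu => (h u hu).trans (h' u hu)⟩
  mul' := by
    intro v v' w w' h h' u hu
    simp only [FreeMonoid.toList_mul, List.sublist_append_iff]
    constructor <;> rintro ⟨x, y, rfl, hx, hy⟩ <;> rw [List.length_append] at hu
    · exact ⟨x, y, rfl, (h x (by omega)).1 hx, (h' y (by omega)).1 hy⟩
    · exact ⟨x, y, rfl, (h x (by omega)).2 hx, (h' y (by omega)).2 hy⟩

theorem finite_subwordCon_quotient (A : Type) [Finite A] (k : ℕ) :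
    Finite (subwordCon A k).Quotient := by
  have : Finite {u : List A // u.length ≤ k} := (List.finite_length_le A k).to_subtype
  let f : (subwordCon A k).Quotient → {u : List A // u.length ≤ k} → Prop :=
    fun x u => Con.liftOn x (fun v => u.1.Sublist v.toList)
      fun _ _ h => propext (h u.1 u.2)
  refine Finite.of_injective f fun x y hxy => ?_
  induction x, y using Con.induction_on₂ with
  | _ v w => exact (Con.eq _).2 fun u hu => (congrFun hxy ⟨u, hu⟩).to_iff

theorem jTrivial_subwordCon_quotient (A : Type) (k : ℕ) :
    JTrivial (subwordCon A k).Quotient := by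
  refine JTrivial.of_eq fun s t a b c d hs ht => ?_
  have key : ∀ s t a b : FreeMonoid A, (s : (subwordCon A k).Quotient) = a * t * b →
      ∀ u : List A, u.length ≤ k → u.Sublist t.toList → u.Sublist s.toList := by
    intro s t a b h u hu hut
    refine ((Con.eq _).1 h u hu).2 ?_
    simp only [FreeMonoid.toList_mul]
    exact (hut.trans (List.sublist_append_right _ _)).trans (List.sublist_append_left _ _)
  induction s, t using Con.induction_on₂ with
  | _ s t =>
    induction a, b using Con.induction_on₂ with
    | _ a b =>
      induction c, d using Con.induction_on₂ with
      | _ c d =>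
        exact (Con.eq _).2 fun u hu => ⟨key t s c d ht u hu, key s t a b hs u hu⟩

theorem exists_jTrivial_universal (A : Type) [Finite A] (k : ℕ) :
    ∃ (N : BFinMonoid) (ψ : FreeMonoid A →* N.carrier), JTrivial N.carrier ∧
      ∀ v w, ψ v = ψ w → ∀ i ≤ k, Universal v.toList i ↔ Universal w.toList i := by
  have := finite_subwordCon_quotient A k
  have := Fintype.ofFinite (subwordCon A k).Quotient
  refine ⟨⟨(subwordCon A k).Quotient⟩, (subwordCon A k).mk', jTrivial_subwordCon_quotient A k,
    fun v w h i hi => ?_⟩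
  have h := (Con.eq _).1 h
  exact forall₂_congr fun u hu => h u (hu.le.trans hi)

/-! ### Reading off blocks from the transduction -/

section Labels

variable {A N : Type} [Monoid N] (ψ : FreeMonoid A →* N)

/-- Some word with image `x` is universal of level `i`. -/
def UniversalImage (x : N) (i : ℕ) : Prop :=
  ∃ v : FreeMonoid A, ψ v = x ∧ Universal v.toList i

theorem universalImage_iff {ψ : FreeMonoid A →* N} {k : ℕ}
    (hψ : ∀ v w, ψ v = ψ w → ∀ i ≤ k, Universal v.toList i ↔ Universal w.toList i)
    {i : ℕ} (hi : i ≤ k) (l : List A) :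
    UniversalImage ψ (ψ (FreeMonoid.ofList l)) i ↔ Universal l i :=
  ⟨fun ⟨v, hv, h⟩ => (hψ v _ hv i hi).1 h, fun h => ⟨_, rfl, h⟩⟩

variable {K : Type} [Monoid K]

open Classical in
/-- Multiply the values of the letters in the `i`-th block from the right. -/
noncomputable def blockHomRight (i : ℕ) (f : A → K) : FreeMonoid (N × A × N) →* K :=
  FreeMonoid.lift fun x =>
    if UniversalImage ψ x.2.2 i ∧ ¬ UniversalImage ψ (ψ (FreeMonoid.of x.2.1) * x.2.2) (i + 1)
    then f x.2.1 else 1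

open Classical in
/-- Multiply the values of the letters in the `i`-th block from the left. -/
noncomputable def blockHomLeft (i : ℕ) (f : A → K) : FreeMonoid (N × A × N) →* K :=
  FreeMonoid.lift fun x =>
    if UniversalImage ψ x.1 i ∧ ¬ UniversalImage ψ (x.1 * ψ (FreeMonoid.of x.2.1)) (i + 1)
    then f x.2.1 else 1

theorem blockHomRight_tau {ψ : FreeMonoid A →* N} {k : ℕ}
    (hψ : ∀ v w, ψ v = ψ w → ∀ i ≤ k, Universal v.toList i ↔ Universal w.toList i)
    {i : ℕ} (hi : i < k) (f : A → K) (w : FreeMonoid A) :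
    blockHomRight ψ i f (tau ψ w) = ((block i w.toList).map f).prod := by
  suffices h : ∀ (l : List A) (p : N),
      blockHomRight ψ i f (FreeMonoid.ofList (tauAux ψ p l)) = ((block i l).map f).prod from
    h _ _
  intro l
  induction l with
  | nil => intro p; simp [tauAux, block]
  | cons a l ih =>
    intro p
    rw [tauAux, FreeMonoid.ofList_cons, map_mul, ih, block, blockHomRight, FreeMonoid.lift_eval_of]
    simp only
    rw [← map_mul, ← FreeMonoid.ofList_cons, universalImage_iff hψ hi.le, universalImage_iff hψ hi]
    split_ifs <;> simp

theorem blockHomLeft_tau {ψ : FreeMonoid A →* N} {k : ℕ}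
    (hψ : ∀ v w, ψ v = ψ w → ∀ i ≤ k, Universal v.toList i ↔ Universal w.toList i)
    {i : ℕ} (hi : i < k) (f : A → K) (w : FreeMonoid A) :
    blockHomLeft ψ i f (tau ψ w) = ((block i w.toList.reverse).reverse.map f).prod := by
  suffices h : ∀ (l q : List A), blockHomLeft ψ i f
      (FreeMonoid.ofList (tauAux ψ (ψ (FreeMonoid.ofList q.reverse)) l)) =
        ((blockFrom i q l).map f).prod by
    rw [← blockFrom_nil, ← h]
    simp [tau]
  intro l
  induction l with
  | nil => intro p; simp [tauAux, blockFrom]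
  | cons a l ih =>
    intro q
    have hq : ψ (FreeMonoid.ofList q.reverse) * ψ (FreeMonoid.of a) =
        ψ (FreeMonoid.ofList (a :: q).reverse) := by
      rw [← map_mul, List.reverse_cons, FreeMonoid.ofList_append, FreeMonoid.ofList_singleton]
    rw [tauAux, FreeMonoid.ofList_cons, map_mul, hq, ih, blockFrom, blockHomLeft,
      FreeMonoid.lift_eval_of]
    simp only
    rw [hq, universalImage_iff hψ hi.le, universalImage_iff hψ hi, universal_reverse,
      universal_reverse]
    split_ifs <;> simp

end Labels

theorem prod_ite_eq_zero_iff {A : Type} [DecidableEq A] (a : A) (l : List A) :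
    (l.map fun b => if b = a then (0 : ZMod 2) else 1).prod = 0 ↔ a ∈ l := by
  rw [List.prod_eq_zero_iff]
  simp

theorem jTrivial_zmod_two : JTrivial (ZMod 2) :=
  JTrivial.of_eq (by decide)

/-- Evaluation of words after deleting the letter `a` takes place in a monoid of the given level,
namely the submonoid generated by all generators other than `a`. -/
theorem AbsorbsFactors.exists_hom_erase {n : ℕ} {M : Type} [Monoid M] [Finite M]
    (ih : ∀ (M : Type) [Monoid M] [Fintype M], AbsorbsFactors M → ∀ g : Fin (n + 1) → M,
      Submonoid.closure (Set.range g) = ⊤ → VMem (n + 1) ⟨M⟩)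
    (hM : AbsorbsFactors M) (g : Fin (n + 2) → M) (a : Fin (n + 2)) :
    ∃ (K : BFinMonoid) (f : Fin (n + 2) → K.carrier) (ι : K.carrier →* M), VMem (n + 1) K ∧
      ∀ b, ι (f b) = if b = a then 1 else g b := by
  let S := Submonoid.closure (Set.range (g ∘ a.succAbove))
  have := Fintype.ofFinite S
  have hmem : ∀ b, b ≠ a → g b ∈ S := by
    intro b hb
    obtain ⟨c, rfl⟩ := Fin.exists_succAbove_eq hb
    exact Submonoid.subset_closure ⟨c, rfl⟩
  refine ⟨⟨S⟩, fun b => if h : b = a then 1 else ⟨g b, hmem b h⟩, S.subtype, ?_,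
    fun b => ?_⟩
  · refine ih S (hM.submonoid S) (fun c => ⟨g (a.succAbove c), hmem _ (a.succAbove_ne c)⟩) ?_
    have hrange : (Set.range fun c => (⟨g (a.succAbove c), hmem _ (a.succAbove_ne c)⟩ : S)) =
        (↑) ⁻¹' Set.range (g ∘ a.succAbove) :=
      Set.ext fun x => by simp [Subtype.ext_iff]
    rw [hrange]
    exact Submonoid.closure_closure_coe_preimage
  · by_cases h : b = a <;> simp [h]

theorem VMem_of_absorbsFactors (n : ℕ) (M : Type) [Monoid M] [Fintype M]
    (hM : AbsorbsFactors M) (g : Fin (n + 1) → M) (hg : Submonoid.closure (Set.range g) = ⊤) :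
    VMem (n + 1) ⟨M⟩ := by
  induction n generalizing M with
  | zero =>
    have hcomm : ∀ x y : M, x * y = y * x := by
      have hpow : ∀ x : M, ∃ m : ℕ, g 0 ^ m = x := by
        intro x
        have hx : x ∈ Submonoid.closure (Set.range g) := hg ▸ Submonoid.mem_top x
        have hrange : Set.range g = {g 0} :=
          Set.ext fun y => ⟨fun ⟨i, hi⟩ => by rw [← hi, Fin.fin_one_eq_zero i]; rfl,
            fun hy => ⟨0, hy.symm⟩⟩
        rwa [hrange, Submonoid.mem_closure_singleton] at hx
      intro x y
      obtain ⟨i, rfl⟩ := hpow x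
      obtain ⟨j, rfl⟩ := hpow y
      exact pow_mul_comm _ _ _
    refine JTrivial.of_eq fun s t a b c d hs ht => ?_
    refine hM.eq_of_mul_eq (b := c * d) (c := a * b) ?_ ?_
    · rw [ht, hcomm c s, mul_assoc]
    · rw [hs, mul_assoc, hcomm t b, ← mul_assoc]
  | succ n ih =>
    let k := Fintype.card M
    obtain ⟨N, ψ, hN, hψ⟩ := exists_jTrivial_universal (Fin (n + 2)) k
    let zeroAt (a b : Fin (n + 2)) : ZMod 2 := if b = a then 0 else 1
    let oneAt (a b : Fin (n + 2)) : M := if b = a then 1 else g b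
    have hR : RefinedBy n fun x y : FreeMonoid (N.carrier × Fin (n + 2) × N.carrier) =>
        ∀ (i : Fin k) (a : Fin (n + 2)),
          (blockHomRight ψ i (zeroAt a) x = blockHomRight ψ i (zeroAt a) y ∧
            blockHomLeft ψ i (zeroAt a) x = blockHomLeft ψ i (zeroAt a) y) ∧
          (blockHomRight ψ i (oneAt a) x = blockHomRight ψ i (oneAt a) y ∧
            blockHomLeft ψ i (oneAt a) x = blockHomLeft ψ i (oneAt a) y) := by
      have hZ : VMem (n + 1) ⟨ZMod 2⟩ := VMem_of_jTrivial n _ jTrivial_zmod_two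
      refine RefinedBy.forall fun i => RefinedBy.forall fun a => ?_
      obtain ⟨K, f, ι, hK, hf⟩ := hM.exists_hom_erase ih g a
      have hfR : ι.comp (blockHomRight ψ i f) = blockHomRight ψ i (oneAt a) :=
        FreeMonoid.hom_eq fun x => by
          simp only [blockHomRight, MonoidHom.comp_apply, FreeMonoid.lift_eval_of, apply_ite ι,
            hf, map_one, oneAt]
      have hfL : ι.comp (blockHomLeft ψ i f) = blockHomLeft ψ i (oneAt a) :=
        FreeMonoid.hom_eq fun x => by
          simp only [blockHomLeft, MonoidHom.comp_apply, FreeMonoid.lift_eval_of, apply_ite ι,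
            hf, map_one, oneAt]
      refine RefinedBy.and (RefinedBy.and ⟨_, _, hZ, fun x y h => h⟩ ⟨_, _, hZ, fun x y h => h⟩)
        (RefinedBy.and ⟨K, blockHomRight ψ i f, hK, fun x y h => ?_⟩
          ⟨K, blockHomLeft ψ i f, hK, fun x y h => ?_⟩)
      · simp only [← hfR, MonoidHom.comp_apply, MonoidHom.comp_apply, h]
      · simp only [← hfL, MonoidHom.comp_apply, MonoidHom.comp_apply, h]
    obtain ⟨K, h, hK, H⟩ := hR
    refine ⟨Fin (n + 2), inferInstance, FreeMonoid.lift g, ?_, N, ψ, hN, K, h, hK,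
      fun v w hvw hτ => ?_⟩
    · rw [← MonoidHom.mrange_eq_top, FreeMonoid.mrange_lift, hg]
    have hu := hψ v w hvw
    have H := fun i (hi : i < k) a => H _ _ hτ ⟨i, hi⟩ a
    have hmem : ∀ i < k, ∀ a, a ∈ block i v.toList ↔ a ∈ block i w.toList := by
      intro i hi a
      have := (H i hi a).1.1
      rw [blockHomRight_tau hψ hi, blockHomRight_tau hψ hi] at this
      rw [← prod_ite_eq_zero_iff, ← prod_ite_eq_zero_iff]
      exact Eq.congr_left this
    have hprod : ∀ i < k, ∀ a, ((block i v.toList).map (oneAt a)).prod =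
        ((block i w.toList).map (oneAt a)).prod := by
      intro i hi a
      have := (H i hi a).2.1
      rwa [blockHomRight_tau hψ hi, blockHomRight_tau hψ hi] at this
    have hop : SameBlocks (fun a => MulOpposite.op (g a)) k v.toList.reverse w.toList.reverse := by
      refine ⟨fun i hi => by rw [universal_reverse, universal_reverse]; exact hu i hi, ?_, ?_⟩
      · intro i hi a
        have := (H i hi a).1.2
        rw [blockHomLeft_tau hψ hi, blockHomLeft_tau hψ hi] at this
        rw [← List.mem_reverse, ← List.mem_reverse (as := block i w.toList.reverse),
          ← prod_ite_eq_zero_iff, ← prod_ite_eq_zero_iff]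
        exact Eq.congr_left this
      · intro i hi a
        have := (H i hi a).2.2
        rw [blockHomLeft_tau hψ hi, blockHomLeft_tau hψ hi] at this
        have hone : (fun b => if b = a then 1 else MulOpposite.op (g b)) =
            fun b => MulOpposite.op (oneAt a b) := by
          funext b
          simp only [oneAt, apply_ite MulOpposite.op, MulOpposite.op_one]
        rw [hone, op_prod_map, op_prod_map, this]
    rw [FreeMonoid.lift_apply, FreeMonoid.lift_apply]
    exact hM.prod_eq hg ⟨hu, hmem, hprod⟩ hop
      ⟨fun i hi => (hu i hi).symm, fun i hi a => (hmem i hi a).symm,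
        fun i hi a => (hprod i hi a).symm⟩

theorem exists_fin_closure_range {M : Type} [Monoid M] {n : ℕ} {S : Finset M}
    (hcard : S.card ≤ n) (hS : Submonoid.closure (S : Set M) = ⊤) :
    ∃ g : Fin n → M, Submonoid.closure (Set.range g) = ⊤ := by
  refine ⟨fun i => if h : i.1 < S.card then (S.equivFin.symm ⟨i, h⟩ : M) else 1, ?_⟩
  rw [eq_top_iff, ← hS]
  refine Submonoid.closure_mono fun x hx => ?_
  refine ⟨⟨S.equivFin ⟨x, hx⟩, (S.equivFin ⟨x, hx⟩).2.trans_le hcard⟩, ?_⟩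
  simp

/-- Collapse of the hierarchy: a finite monoid in `DA` generated by `n > 0`
elements belongs to `V_n`. -/
theorem DA_collapse (n : ℕ) (hn : 0 < n) (M : Type) [Monoid M] [Fintype M]
    (hDA : ∀ x y z : M,
      omegaPow (x * y * z) * y * omegaPow (x * y * z) = omegaPow (x * y * z))
    (hgen : ∃ S : Finset M, S.card ≤ n ∧ Submonoid.closure (S : Set M) = ⊤) :
    VMem n ⟨M⟩ := by
  obtain ⟨S, hcard, hS⟩ := hgen
  obtain ⟨n, rfl⟩ := Nat.exists_eq_add_one.2 hn
  obtain ⟨g, hg⟩ := exists_fin_closure_range hcard hS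
  exact VMem_of_absorbsFactors n M (absorbsFactors_of_omegaPow hDA) g hg
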